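/- For all integers m and n with 3 ≤ m ≤ n, m odd, and (m, n) ≠ (3, 3), the two-color Ramsey number of cycles satisfies R(C_m, C_n) = 2n − 1. -/

import Mathlib

open SimpleGraph

/-- Every red/blue coloring of the edges of `K_N` (red = `0`, blue = `1`) contains a red
copy of `G` or a blue copy of `H`. -/
def RamseyProp {V W : Type*} (G : SimpleGraph V) (H : SimpleGraph W) (N : ℕ) : Prop :=
  ∀ c : Sym2 (Fin N) → Fin 2,
    (∃ f : V ↪ Fin N, ∀ u v, G.Adj u v → c s(f u, f v) = 0) ∨
    (∃ f : W ↪ Fin N, ∀ u v, H.Adj u v → c s(f u, f v) = 1)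

/-- The two-color Ramsey number `R(G, H)`: the minimum `N` such that every red/blue
coloring of the edges of `K_N` contains a red copy of `G` or a blue copy of `H`. -/
noncomputable def ramseyNumber {V W : Type*} (G : SimpleGraph V) (H : SimpleGraph W) : ℕ :=
  sInf {N | RamseyProp G H N}

section RC
open Classical

def HasCyc {V : Type*} (R : V → V → Prop) (m : ℕ) : Prop :=
  ∃ (a : V) (l : List V), (a :: l).length = m ∧ (a :: l).Nodup ∧ List.IsChain R (a :: l ++ [a])

/-- Alternating path building. -/
lemma alt_path {V : Type*} (R : V → V → Prop) (hR : ∀ a b, R a b → R b a) :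
    ∀ (j : ℕ) (P Y T : Finset V) (p0 : V) (d : ℕ),
      p0 ∉ P → p0 ∉ Y → p0 ∉ T → Disjoint P Y → Disjoint P T → Disjoint Y T →
      j ≤ P.card →
      (∀ p ∈ insert p0 P, ∀ t ∈ T, R p t) →
      (∀ p ∈ insert p0 P, d ≤ (Y.filter (fun y => R p y)).card) →
      (T.card < j → (Y.card : ℤ) <
        ((T.card : ℤ) + 2) * (d - (j - T.card) + 1) + (j - T.card - 1)) →
      ∃ (l : List V) (C : Finset V) (e : V), l.length = 2 * j ∧ (p0 :: l).Nodup ∧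
        List.IsChain R (p0 :: l) ∧ (p0 :: l).getLast? = some e ∧ e ∈ insert p0 P ∧
        C ⊆ Y ∪ T ∧ C.card = j ∧ ∀ v ∈ l, v ∈ P ∨ v ∈ C := by
  intro j
  induction j with
  | zero =>
    intro P Y T p0 d _ _ _ _ _ _ _ _ _ _
    exact ⟨[], ∅, p0, by simp⟩
  | succ j ih =>
    intro P Y T p0 d hpP hpY hpT hPY hPT hYT hcard hT hd hnum
    have step : ∀ (y p : V) (Y' T' : Finset V) (d' : ℕ), y ∈ Y ∪ T → y ∉ Y' → y ∉ T' → p ∈ P →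
        R p0 y → R y p → Y' ⊆ Y → T' ⊆ T →
        (∀ q ∈ P, d' ≤ (Y'.filter (fun y => R q y)).card) →
        (T'.card < j → (Y'.card : ℤ) <
          ((T'.card : ℤ) + 2) * (d' - (j - T'.card) + 1) + (j - T'.card - 1)) →
        ∃ (l : List V) (C : Finset V) (e : V), l.length = 2 * (j + 1) ∧ (p0 :: l).Nodup ∧
        List.IsChain R (p0 :: l) ∧ (p0 :: l).getLast? = some e ∧ e ∈ insert p0 P ∧
        C ⊆ Y ∪ T ∧ C.card = j + 1 ∧ ∀ v ∈ l, v ∈ P ∨ v ∈ C := by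
      intro y p Y' T' d' hy hyY hyT hp h1 h2 hY' hT' hd' hn'
      have hins : insert p (P.erase p) = P := Finset.insert_erase hp
      have hPY2 := Finset.disjoint_left.1 hPY
      have hPT2 := Finset.disjoint_left.1 hPT
      obtain ⟨l, C, e, hl, hnd, hch, hlast, he, hC, hCc, hv⟩ := ih (P.erase p) Y' T' p d'
        (by simp) (fun h => hPY2 hp (hY' h)) (fun h => hPT2 hp (hT' h))
        (hPY.mono (Finset.erase_subset _ _) hY') (hPT.mono (Finset.erase_subset _ _) hT')
        (hYT.mono hY' hT') (by rw [Finset.card_erase_of_mem hp]; omega)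
        (by rw [hins]; intro q hq t ht; exact hT q (by simp [hq]) t (hT' ht))
        (by rw [hins]; exact hd') hn'
      have hyC : y ∉ C := by
        intro h; have := hC h; simp only [Finset.mem_union] at this; tauto
      have hCY : ∀ v ∈ C, v ∈ Y ∨ v ∈ T := by
        intro v h; have := hC h; simp only [Finset.mem_union] at this
        rcases this with h | h
        · exact Or.inl (hY' h)
        · exact Or.inr (hT' h)
      have hyP : y ∉ P := by
        intro h; simp only [Finset.mem_union] at hy
        rcases hy with h' | h'
        · exact hPY2 h h'
        · exact hPT2 h h'
      have hyp0 : p0 ≠ y := by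
        rintro rfl; simp only [Finset.mem_union] at hy; tauto
      refine ⟨y :: p :: l, insert y C, e, by simp [hl]; ring, ?_, ?_, ?_, ?_, ?_, ?_, ?_⟩
      · rw [List.nodup_cons, List.nodup_cons]
        refine ⟨?_, ?_, hnd⟩
        · intro h
          rcases List.mem_cons.1 h with h | h
          · exact hyp0 h
          rcases List.mem_cons.1 h with h | h
          · exact hpP (h ▸ hp)
          rcases hv _ h with h | h
          · exact hpP (Finset.mem_of_mem_erase h)
          · rcases hCY _ h with h | h
            · exact hpY h
            · exact hpT h
        · intro h
          rcases List.mem_cons.1 h with h | h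
          · exact hyP (h ▸ hp)
          rcases hv _ h with h | h
          · exact hyP (Finset.mem_of_mem_erase h)
          · exact hyC h
      · exact List.IsChain.cons_cons h1 (List.IsChain.cons_cons h2 hch)
      · simpa using hlast
      · rw [hins] at he; simp [he]
      · intro v hv
        rcases Finset.mem_insert.1 hv with rfl | h
        · exact hy
        · simpa using hCY v h
      · rw [Finset.card_insert_of_notMem hyC, hCc]
      · intro v h
        rcases List.mem_cons.1 h with h | h
        · right; simp [h]
        rcases List.mem_cons.1 h with h | h
        · left; exact h ▸ hp
        rcases hv _ h with h | h
        · left; exact Finset.mem_of_mem_erase h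
        · right; simp [h]
    have hPne : P.Nonempty := by rw [← Finset.card_pos]; omega
    obtain ⟨p1, hp1⟩ := hPne
    by_cases hjT : j + 1 ≤ T.card
    · have : T.Nonempty := by rw [← Finset.card_pos]; omega
      obtain ⟨t, ht⟩ := this
      refine step t p1 Y (T.erase t) d (by simp [ht]) (fun h => Finset.disjoint_left.1 hYT h ht)
        (by simp) hp1 (hT p0 (by simp) t ht) (hR _ _ (hT p1 (by simp [hp1]) t ht)) subset_rfl
        (Finset.erase_subset _ _) (fun q hq => hd q (by simp [hq])) ?_
      intro h; rw [Finset.card_erase_of_mem ht] at h; omega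
    push Not at hjT
    specialize hnum hjT
    by_cases hex : ∃ y ∈ Y, ∃ p ∈ P, R p0 y ∧ R y p
    · obtain ⟨y, hy, p, hp, h1, h2⟩ := hex
      refine step y p (Y.erase y) T (d - 1) (by simp [hy]) (by simp)
        (fun h => Finset.disjoint_left.1 hYT hy h) hp h1 h2 (Finset.erase_subset _ _) subset_rfl
        ?_ ?_
      · intro q hq
        have := hd q (by simp [hq])
        rw [Finset.filter_erase]
        have h3 := Finset.pred_card_le_card_erase (s := Y.filter (fun y => R q y)) (a := y)
        omega
      · intro h
        rw [Finset.card_erase_of_mem hy]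
        have : 1 ≤ Y.card := Finset.card_pos.2 ⟨y, hy⟩
        have h1d : ((d : ℤ) - 1) ≤ ((d - 1 : ℕ) : ℤ) := by omega
        push_cast [this] at hnum ⊢
        nlinarith [mul_le_mul_of_nonneg_left h1d (show (0 : ℤ) ≤ (T.card : ℤ) + 2 by positivity)]
    · push Not at hex
      set Z := Y.filter (fun y => R p0 y) with hZ
      have hZd : d ≤ Z.card := hd p0 (by simp)
      have hZP : ∀ q ∈ P, Disjoint Z (Y.filter (fun y => R q y)) := by
        intro q hq
        rw [Finset.disjoint_left]
        intro y hy hy'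
        simp only [hZ, Finset.mem_filter] at hy hy'
        exact hex y hy.1 q hq hy.2 (hR _ _ hy'.2)
      by_cases hTe : T = ∅
      · exfalso
        have h1 := hd p1 (by simp [hp1])
        have h2 : (Z ∪ Y.filter (fun y => R p1 y)).card ≤ Y.card :=
          Finset.card_le_card (Finset.union_subset (Finset.filter_subset _ _)
            (Finset.filter_subset _ _))
        rw [Finset.card_union_of_disjoint (hZP p1 hp1)] at h2
        subst hTe
        simp at hnum
        omega
      · obtain ⟨t, ht⟩ := Finset.nonempty_iff_ne_empty.2 hTe
        refine step t p1 (Y \ Z) (T.erase t) d (by simp [ht])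
          (fun h => Finset.disjoint_left.1 hYT (Finset.sdiff_subset h) ht)
          (by simp) hp1 (hT p0 (by simp) t ht) (hR _ _ (hT p1 (by simp [hp1]) t ht))
          Finset.sdiff_subset (Finset.erase_subset _ _) ?_ ?_
        · intro q hq
          refine (hd q (by simp [hq])).trans (Finset.card_le_card ?_)
          intro y hy
          have := Finset.disjoint_right.1 (hZP q hq) hy
          simp only [Finset.mem_filter, Finset.mem_sdiff] at hy ⊢
          exact ⟨⟨hy.1, this⟩, hy.2⟩
        · intro h
          have hT1 : 1 ≤ T.card := Finset.card_pos.2 ⟨t, ht⟩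
          have hZs : Z ⊆ Y := Finset.filter_subset _ _
          have hYZ : ((Y \ Z).card : ℤ) = Y.card - Z.card := by
            rw [Finset.card_sdiff_of_subset hZs, Nat.cast_sub (Finset.card_le_card hZs)]
          rw [Finset.card_erase_of_mem ht, hYZ]
          push_cast [hT1] at hnum ⊢
          have : (d : ℤ) ≤ Z.card := by exact_mod_cast hZd
          have : (T.card : ℤ) ≤ j := by omega
          nlinarith

/-- Closing an alternating path into a cycle. -/
lemma close_path {V : Type*} (R : V → V → Prop) (j : ℕ) (P C : Finset V) (p0 e t : V)
    (l q : List V) (hl : l.length = 2 * j) (hnd : (p0 :: l).Nodup)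
    (hch : List.IsChain R (p0 :: l)) (hlast : (p0 :: l).getLast? = some e)
    (hv : ∀ v ∈ l, v ∈ P ∨ v ∈ C)
    (hp0 : p0 ∉ t :: q) (hP : ∀ v ∈ t :: q, v ∉ P) (hC : ∀ v ∈ t :: q, v ∉ C)
    (hq : (t :: q).Nodup) (het : R e t) (hqc : List.IsChain R (t :: q ++ [p0])) :
    HasCyc R (2 * j + 2 + q.length) := by
  refine ⟨p0, l ++ t :: q, by simp [hl]; ring, ?_, ?_⟩
  · rw [← List.cons_append, List.nodup_append]
    refine ⟨hnd, hq, ?_⟩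
    rintro a ha b hb rfl
    rcases List.mem_cons.1 ha with h | h
    · exact hp0 (h ▸ hb)
    · rcases hv a h with h | h
      · exact hP a hb h
      · exact hC a hb h
  · have : p0 :: (l ++ t :: q) ++ [p0] = (p0 :: l) ++ (t :: q ++ [p0]) := by simp
    rw [this, List.isChain_append]
    refine ⟨hch, hqc, ?_⟩
    intro x hx y hy
    rw [hlast] at hx
    simp at hx hy
    subst hx; subst hy; exact het
end RC

section RC
open Classical

def seg {V : Type*} (y : ℕ → V) : ℕ → ℕ → List V
  | _, 0 => []
  | a, L + 1 => y a :: seg y (a + 1) L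

lemma seg_length {V : Type*} (y : ℕ → V) (a L : ℕ) : (seg y a L).length = L := by
  induction L generalizing a with
  | zero => rfl
  | succ L ih => simp [seg, ih]

lemma mem_seg {V : Type*} (y : ℕ → V) (a L : ℕ) (v : V) :
    v ∈ seg y a L ↔ ∃ t, a ≤ t ∧ t < a + L ∧ v = y t := by
  induction L generalizing a with
  | zero => simp [seg]; intros; omega
  | succ L ih =>
    simp only [seg, List.mem_cons, ih]
    constructor
    · rintro (h | ⟨t, h1, h2, h3⟩)
      · exact ⟨a, le_refl _, by omega, h⟩
      · exact ⟨t, by omega, by omega, h3⟩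
    · rintro ⟨t, h1, h2, h3⟩
      by_cases h : t = a
      · left; rw [h3, h]
      · right; exact ⟨t, by omega, by omega, h3⟩

lemma seg_nodup {V : Type*} (y : ℕ → V) (n : ℕ) (hy : ∀ s t, s < t → t < s + n → y s ≠ y t)
    (a L : ℕ) (hL : L ≤ n) : (seg y a L).Nodup := by
  induction L generalizing a with
  | zero => simp [seg]
  | succ L ih =>
    simp only [seg, List.nodup_cons]
    refine ⟨?_, ih (a + 1) (by omega)⟩
    rw [mem_seg]
    rintro ⟨t, h1, h2, h3⟩
    exact hy a t (by omega) (by omega) h3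

lemma seg_head {V : Type*} (y : ℕ → V) (a L : ℕ) (hL : 0 < L) : (seg y a L).head? = some (y a) := by
  cases L with
  | zero => omega
  | succ L => simp [seg]

lemma seg_last {V : Type*} (y : ℕ → V) (a L : ℕ) (hL : 0 < L) :
    (seg y a L).getLast? = some (y (a + L - 1)) := by
  induction L generalizing a with
  | zero => omega
  | succ L ih =>
    rcases Nat.eq_zero_or_pos L with rfl | h
    · simp [seg]
    · have := ih (a + 1) h
      rw [seg, List.getLast?_cons, this]
      simp

lemma seg_chain {V : Type*} (B : V → V → Prop) (y : ℕ → V) (hB : ∀ t, B (y t) (y (t + 1)))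
    (a L : ℕ) : List.IsChain B (seg y a L) := by
  induction L generalizing a with
  | zero => simp [seg]
  | succ L ih =>
    cases L with
    | zero => simp [seg]
    | succ L => exact List.IsChain.cons_cons (hB a) (ih (a + 1))

/-- one segment, closed by a path `b :: bs` -/
lemma cyc_one {V : Type*} (B : V → V → Prop) (n : ℕ) (y : ℕ → V)
    (hB : ∀ t, B (y t) (y (t + 1))) (hy : ∀ s t, s < t → t < s + n → y s ≠ y t)
    (a L : ℕ) (hL : L ≤ n) (hL0 : 0 < L) (b e : V) (bs : List V)
    (hnd : (b :: bs).Nodup) (hbs : ∀ v ∈ b :: bs, ∀ t, v ≠ y t) (hch : List.IsChain B (b :: bs))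
    (he : (b :: bs).getLast? = some e) (h1 : B e (y a)) (h2 : B (y (a + L - 1)) b) :
    HasCyc B (bs.length + 1 + L) := by
  refine ⟨b, bs ++ seg y a L, by simp [seg_length]; ring, ?_, ?_⟩
  · rw [← List.cons_append, List.nodup_append]
    refine ⟨hnd, seg_nodup y n hy a L hL, ?_⟩
    rintro v hv w hw rfl
    obtain ⟨t, -, -, h⟩ := (mem_seg _ _ _ _).1 hw
    exact hbs v hv t h
  · have : b :: (bs ++ seg y a L) ++ [b] = (b :: bs) ++ (seg y a L ++ [b]) := by simp
    rw [this, List.isChain_append, List.isChain_append]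
    refine ⟨hch, ⟨seg_chain B y hB a L, by simp, ?_⟩, ?_⟩
    · intro v hv w hw
      rw [seg_last y a L hL0] at hv
      simp at hv hw; subst hv; subst hw; exact h2
    · intro v hv w hw
      rw [he] at hv
      rw [List.head?_append, seg_head y a L hL0] at hw
      simp at hv hw; subst hv; subst hw; exact h1

lemma cyc_two {V : Type*} (B : V → V → Prop) (hs : ∀ a b, B a b → B b a) (n : ℕ) (y : ℕ → V)
    (hB : ∀ t, B (y t) (y (t + 1))) (hy : ∀ s t, s < t → t < s + n → y s ≠ y t)
    (p : ℕ) (hp0 : 0 < p) (hp : p < n) (u : V) (hu : ∀ t, u ≠ y t)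
    (h1 : B u (y p)) (h2 : B (y 1) (y (p + 1))) (h3 : B (y n) u) :
    HasCyc B (n + 1) := by
  refine ⟨u, (seg y 1 p).reverse ++ seg y (p + 1) (n - p), by simp [seg_length]; omega, ?_, ?_⟩
  · rw [List.nodup_cons, List.nodup_append]
    refine ⟨?_, ?_, seg_nodup y n hy _ _ (by omega), ?_⟩
    · intro h
      rw [List.mem_append, List.mem_reverse, mem_seg, mem_seg] at h
      rcases h with ⟨t, -, -, h⟩ | ⟨t, -, -, h⟩ <;> exact hu t h
    · rw [List.nodup_reverse]; exact seg_nodup y n hy _ _ (by omega)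
    · rintro v hv w hw rfl
      rw [List.mem_reverse, mem_seg] at hv
      rw [mem_seg] at hw
      obtain ⟨t, a1, a2, a3⟩ := hv
      obtain ⟨t', b1, b2, b3⟩ := hw
      exact hy t t' (by omega) (by omega) (a3.symm.trans b3)
  · have : u :: ((seg y 1 p).reverse ++ seg y (p + 1) (n - p)) ++ [u] =
      [u] ++ ((seg y 1 p).reverse ++ (seg y (p + 1) (n - p) ++ [u])) := by simp
    rw [this, List.isChain_append, List.isChain_append, List.isChain_append]
    refine ⟨by simp, ⟨?_, ⟨seg_chain B y hB _ _, by simp, ?_⟩, ?_⟩, ?_⟩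
    · rw [List.isChain_reverse]
      exact (seg_chain B y hB 1 p).imp (fun a b h => hs _ _ h)
    · intro v hv w hw
      rw [seg_last y _ _ (by omega)] at hv
      have e : p + 1 + (n - p) - 1 = n := by omega
      simp [e] at hv hw; subst hv; subst hw; exact h3
    · intro v hv w hw
      rw [List.getLast?_reverse, seg_head y _ _ hp0] at hv
      rw [List.head?_append, seg_head y _ _ (by omega)] at hw
      simp at hv hw; subst hv; subst hw; exact h2
    · intro v hv w hw
      rw [List.head?_append, List.head?_reverse, seg_last y _ _ hp0] at hw
      have e : 1 + p - 1 = p := by omega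
      simp [e] at hv hw; subst hv; subst hw; exact h1

lemma cyc_three {V : Type*} (B : V → V → Prop) (hs : ∀ a b, B a b → B b a) (n : ℕ) (y : ℕ → V)
    (hB : ∀ t, B (y t) (y (t + 1))) (hy : ∀ s t, s < t → t < s + n → y s ≠ y t)
    (p : ℕ) (hp0 : 0 < p) (hp : p + 1 < n) (u w : V) (huw : u ≠ w) (hu : ∀ t, u ≠ y t)
    (hw : ∀ t, w ≠ y t)
    (h1 : B w (y 1)) (h2 : B (y p) u) (h3 : B u (y n)) (h4 : B (y (p + 2)) w) :
    HasCyc B (n + 1) := by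
  refine ⟨w, seg y 1 p ++ u :: (seg y (p + 2) (n - p - 1)).reverse,
    by simp [seg_length]; omega, ?_, ?_⟩
  · rw [List.nodup_cons, List.nodup_append, List.nodup_cons]
    refine ⟨?_, seg_nodup y n hy _ _ (by omega), ⟨?_, ?_⟩, ?_⟩
    · intro h
      rw [List.mem_append, List.mem_cons, List.mem_reverse, mem_seg, mem_seg] at h
      rcases h with ⟨t, -, -, h⟩ | h | ⟨t, -, -, h⟩
      · exact hw t h
      · exact huw h.symm
      · exact hw t h
    · rw [List.mem_reverse, mem_seg]
      rintro ⟨t, -, -, h⟩; exact hu t h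
    · rw [List.nodup_reverse]; exact seg_nodup y n hy _ _ (by omega)
    · rintro v hv w' hw' rfl
      rw [mem_seg] at hv
      obtain ⟨t, a1, a2, a3⟩ := hv
      rw [List.mem_cons, List.mem_reverse, mem_seg] at hw'
      rcases hw' with h | ⟨t', b1, b2, b3⟩
      · exact hu t (h.symm.trans a3)
      · exact hy t t' (by omega) (by omega) (a3.symm.trans b3)
  · have : w :: (seg y 1 p ++ u :: (seg y (p + 2) (n - p - 1)).reverse) ++ [w] =
      [w] ++ (seg y 1 p ++ ([u] ++ ((seg y (p + 2) (n - p - 1)).reverse ++ [w]))) := by simp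
    rw [this, List.isChain_append, List.isChain_append, List.isChain_append, List.isChain_append]
    refine ⟨by simp, ⟨seg_chain B y hB _ _, ⟨by simp, ⟨?_, by simp, ?_⟩, ?_⟩, ?_⟩, ?_⟩
    · rw [List.isChain_reverse]
      exact (seg_chain B y hB _ _).imp (fun a b h => hs _ _ h)
    · intro v hv w' hw'
      rw [List.getLast?_reverse, seg_head y _ _ (by omega)] at hv
      simp at hv hw'; subst hv; subst hw'; exact h4
    · intro v hv w' hw'
      rw [List.head?_append, List.head?_reverse, seg_last y _ _ (by omega)] at hw'
      have e : p + 2 + (n - p - 1) - 1 = n := by omega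
      simp [e] at hv hw'; subst hv; subst hw'; exact h3
    · intro v hv w' hw'
      rw [seg_last y _ _ hp0] at hv
      have e : 1 + p - 1 = p := by omega
      simp [e] at hv hw'; subst hv; subst hw'; exact h2
    · intro v hv w' hw'
      rw [List.head?_append, seg_head y _ _ hp0] at hw'
      simp at hv hw'; subst hv; subst hw'; exact h1

/-- conversion to a cyclically indexed family -/
lemma HasCyc.exists_fun {V : Type*} {B : V → V → Prop} {n : ℕ} (hn : 2 ≤ n) (h : HasCyc B n) :
    ∃ x : ZMod n → V, Function.Injective x ∧ ∀ i, B (x i) (x (i + 1)) := by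
  obtain ⟨a, l, hl, hnd, hch⟩ := h
  have : NeZero n := ⟨by omega⟩
  have hv : ∀ i : ZMod n, i.val < (a :: l).length := fun i => by rw [hl]; exact ZMod.val_lt i
  refine ⟨fun i => (a :: l)[i.val]'(hv i), ?_, ?_⟩
  · intro i j hij
    exact ZMod.val_injective n ((List.Nodup.getElem_inj_iff hnd).1 hij)
  · intro i
    have h1 : Fact (1 < n) := ⟨by omega⟩
    rw [List.isChain_iff_getElem] at hch
    have := hch i.val (by have := hv i; simp at this ⊢; omega)
    simp only [List.length_cons] at hl
    have hvi := hv i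
    simp only [List.length_cons] at hvi
    have hval : (i + 1).val = (i.val + 1) % n := by
      rw [ZMod.val_add, ZMod.val_one]
    rcases Nat.lt_or_ge (i.val + 1) n with hlt | hge
    · rw [Nat.mod_eq_of_lt hlt] at hval
      simp only [hval]
      rw [List.getElem_append_left (by simp; omega), List.getElem_append_left (by simp; omega)] at this
      exact this
    · have e : i.val + 1 = n := by omega
      rw [e, Nat.mod_self] at hval
      simp only [hval]
      rw [List.getElem_append_left (by simp; omega), List.getElem_append_right (by simp; omega)] at this
      simpa using this
end RC

section RC
open Classical

structure Ctx {V : Type*} (R : V → V → Prop) (n : ℕ) (x : ZMod n → V) (U : Finset V) : Prop where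
  hR : ∀ a b, R a b → R b a
  hn : 3 ≤ n
  inj : Function.Injective x
  blue : ∀ i, ¬ R (x i) (x (i + 1))
  hU : ∀ u ∈ U, ∀ i, u ≠ x i
  hno : ¬ HasCyc (fun a b => ¬ R a b) (n + 1)

variable {V : Type*} {R : V → V → Prop} {n : ℕ} {x : ZMod n → V} {U : Finset V}

lemma Ctx.blue' (h : Ctx R n x U) (i : ZMod n) (t : ℕ) :
    ¬ R (x (i + (t : ZMod n))) (x (i + ((t + 1 : ℕ) : ZMod n))) := by
  have := h.blue (i + (t : ZMod n))
  push_cast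
  rwa [← add_assoc]

lemma Ctx.inj' (h : Ctx R n x U) (i : ZMod n) (s t : ℕ) (h1 : s < t) (h2 : t < s + n) :
    x (i + (s : ZMod n)) ≠ x (i + (t : ZMod n)) := by
  intro e
  have e := add_left_cancel (h.inj e)
  rw [ZMod.natCast_eq_natCast_iff, Nat.modEq_iff_dvd' h1.le] at e
  have := Nat.le_of_dvd (by omega) e
  omega

/-- a blue path through `U` closing a segment of the blue cycle -/
lemma Ctx.f5 (h : Ctx R n x U) (i : ZMod n) (v : ℕ) (hv0 : 0 < v) (hv : v ≤ n) (b e : V)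
    (bs : List V) (hlen : bs.length + v = n) (hnd : (b :: bs).Nodup) (hbs : ∀ w ∈ b :: bs, w ∈ U)
    (hch : List.IsChain (fun a b => ¬ R a b) (b :: bs)) (he : (b :: bs).getLast? = some e)
    (h1 : ¬ R e (x i)) (h2 : ¬ R b (x (i + ((v - 1 : ℕ) : ZMod n)))) : False := by
  have := cyc_one (fun a b => ¬ R a b) n (fun t => x (i + (t : ZMod n))) (h.blue' i) (h.inj' i)
    0 v hv hv0 b e bs hnd (fun w hw t => h.hU w (hbs w hw) _) hch he (by simpa using h1)
    (by rw [zero_add]; exact fun hh => h2 (h.hR _ _ hh))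
  apply h.hno
  have e : bs.length + 1 + v = n + 1 := by omega
  rwa [e] at this

lemma Ctx.f1 (h : Ctx R n x U) {u : V} (hu : u ∈ U) {i : ZMod n} (h1 : ¬ R u (x i)) :
    R u (x (i + 1)) := by
  by_contra h2
  have hn := h.hn
  refine h.f5 (i + 1) n (by omega) le_rfl u u [] (by simp) (by simp) (by simpa using hu) (by simp)
    (by simp) h2 ?_
  have : i + 1 + ((n - 1 : ℕ) : ZMod n) = i := by
    rw [Nat.cast_sub (by omega)]; simp
  rwa [this]

lemma Ctx.f3 (h : Ctx R n x U) {u w : V} (hu : u ∈ U) (hw : w ∈ U) (huw : u ≠ w)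
    (hb : ¬ R u w) {i : ZMod n} (h1 : ¬ R u (x i)) :
    R w (x (i + 2)) := by
  by_contra h2
  have hn := h.hn
  refine h.f5 (i + 2) (n - 1) (by omega) (by omega) u w [w] (by simp; omega) (by simp [huw])
    (by simp [hu, hw]) (by simp [hb]) (by simp) h2 ?_
  have : i + 2 + ((n - 1 - 1 : ℕ) : ZMod n) = i := by
    rw [Nat.sub_sub, Nat.cast_sub (by omega)]; simp
  rwa [this]

lemma Ctx.exists_nat (h : Ctx R n x U) (i j : ZMod n) (hij : i ≠ j) :
    ∃ p : ℕ, 0 < p ∧ p < n ∧ j = i + (p : ZMod n) := by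
  have hn := h.hn
  have : NeZero n := ⟨by omega⟩
  refine ⟨(j - i).val, ?_, ZMod.val_lt _, by simp⟩
  rw [Nat.pos_iff_ne_zero, Ne, ZMod.val_eq_zero, sub_eq_zero]
  exact hij.symm

lemma Ctx.f2 (h : Ctx R n x U) {u : V} (hu : u ∈ U) {i j : ZMod n} (hij : i ≠ j)
    (h1 : ¬ R u (x i)) (h2 : ¬ R u (x j)) : R (x (i + 1)) (x (j + 1)) := by
  by_contra h3
  obtain ⟨p, hp0, hp, rfl⟩ := h.exists_nat i j hij
  refine h.hno (cyc_two (fun a b => ¬ R a b) (fun a b hh h' => hh (h.hR _ _ h')) n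
    (fun t => x (i + (t : ZMod n))) (h.blue' i) (h.inj' i) p hp0 hp u (fun t => h.hU u hu _) h2 ?_ ?_)
  · push_cast
    rwa [← add_assoc]
  · simp only [CharP.cast_eq_zero, add_zero]
    exact fun hh => h1 (h.hR _ _ hh)

lemma Ctx.f4 (h : Ctx R n x U) {u w : V} (hu : u ∈ U) (hw : w ∈ U) (huw : u ≠ w) {i j : ZMod n}
    (h1 : ¬ R u (x i)) (h2 : ¬ R u (x j)) (h3 : ¬ R w (x (i + 1))) : R w (x (j + 2)) := by
  by_cases hij : i = j
  · subst hij
    have := h.f1 hw h3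
    rwa [add_assoc, one_add_one_eq_two] at this
  by_contra h4
  obtain ⟨p, hp0, hp, rfl⟩ := h.exists_nat i j hij
  have hp1 : p + 1 ≠ n := by
    intro e
    have := h.f1 hu h2
    have e2 : ((p : ZMod n) + 1) = 0 := by
      have : ((p + 1 : ℕ) : ZMod n) = 0 := by rw [e]; simp
      simpa using this
    rw [add_assoc, e2, add_zero] at this
    exact h1 this
  refine h.hno (cyc_three (fun a b => ¬ R a b) (fun a b hh h' => hh (h.hR _ _ h')) n
    (fun t => x (i + (t : ZMod n))) (h.blue' i) (h.inj' i) p hp0 (by omega) u w huw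
    (fun t => h.hU u hu _) (fun t => h.hU w hw _) ?_ ?_ ?_ ?_)
  · simpa using h3
  · exact fun hh => h2 (h.hR _ _ hh)
  · simpa using h1
  · push_cast
    rw [← add_assoc]
    exact fun hh => h4 (h.hR _ _ hh)
end RC

section RC
open Classical

variable {V : Type*} {R : V → V → Prop} {n : ℕ} {x : ZMod n → V} {U : Finset V}

/-- indices of blue neighbours of `u` on the cycle -/
noncomputable def SS [NeZero n] (R : V → V → Prop) (x : ZMod n → V) (u : V) : Finset (ZMod n) :=
  Finset.univ.filter (fun i => ¬ R u (x i))

lemma mem_SS [NeZero n] {u : V} {i : ZMod n} : i ∈ SS R x u ↔ ¬ R u (x i) := by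
  simp [SS]

/-- the cycle vertices -/
noncomputable def XX [NeZero n] (x : ZMod n → V) : Finset V := Finset.univ.image x

lemma mem_XX [NeZero n] (i : ZMod n) : x i ∈ XX x := by simp [XX]

lemma exists_of_mem_XX [NeZero n] {v : V} (h : v ∈ XX x) : ∃ i, v = x i := by
  simp [XX] at h
  obtain ⟨i, hi⟩ := h
  exact ⟨i, hi.symm⟩

noncomputable def TT [NeZero n] (R : V → V → Prop) (x : ZMod n → V) (u : V) (c : ZMod n) :
    Finset V := (SS R x u).image (fun i => x (i + c))

lemma mem_TT [NeZero n] {u v : V} {c : ZMod n} :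
    v ∈ TT R x u c ↔ ∃ i, ¬ R u (x i) ∧ v = x (i + c) := by
  simp only [TT, Finset.mem_image, mem_SS]
  constructor
  · rintro ⟨i, h1, h2⟩; exact ⟨i, h1, h2.symm⟩
  · rintro ⟨i, h1, h2⟩; exact ⟨i, h1, h2.symm⟩

lemma TT_sub [NeZero n] (u : V) (c : ZMod n) : TT R x u c ⊆ XX x := by
  intro v hv
  obtain ⟨i, -, rfl⟩ := mem_TT.1 hv
  exact mem_XX _

lemma Ctx.card_TT [NeZero n] (h : Ctx R n x U) (u : V) (c : ZMod n) :
    (TT R x u c).card = (SS R x u).card := by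
  apply Finset.card_image_of_injective
  intro i j hij
  exact add_right_cancel (h.inj hij)

lemma Ctx.card_XX [NeZero n] (h : Ctx R n x U) : (XX x).card = n := by
  rw [XX, Finset.card_image_of_injective _ h.inj, Finset.card_univ, ZMod.card]

lemma Ctx.disjUX [NeZero n] (h : Ctx R n x U) {u v : V} (hu : u ∈ U) (hv : v ∈ XX x) : u ≠ v := by
  obtain ⟨i, rfl⟩ := exists_of_mem_XX hv
  exact h.hU u hu i

lemma card_blue_le [NeZero n] (Y : Finset V) (hY : Y ⊆ XX x) (p : V) :
    (Y.filter (fun y => ¬ R p y)).card ≤ (SS R x p).card := by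
  refine (Finset.card_le_card ?_).trans (Finset.card_image_le (f := x))
  intro y hy
  rw [Finset.mem_filter] at hy
  obtain ⟨i, rfl⟩ := exists_of_mem_XX (hY hy.1)
  exact Finset.mem_image_of_mem _ (mem_SS.2 hy.2)

lemma card_red_ge [NeZero n] (Y : Finset V) (hY : Y ⊆ XX x) (p : V) (s : ℕ)
    (hs : (SS R x p).card ≤ s) :
    Y.card - s ≤ (Y.filter (fun y => R p y)).card := by
  have h1 := card_blue_le (R := R) Y hY p
  have h2 := Finset.card_filter_add_card_filter_not (s := Y) (fun y => R p y)
  omega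

lemma Ctx.wrap [NeZero n] (h : Ctx R n x U) (s j : ℕ) (P T Y : Finset V) (hPU : P ⊆ U)
    (hTX : T ⊆ XX x) (hYX : Y ⊆ XX x) (hYT : Disjoint Y T)
    (hT : ∀ p ∈ P, ∀ t ∈ T, R p t) (hs : ∀ p ∈ P, (SS R x p).card ≤ s)
    (t p0 : V) (ht : t ∈ T) (hp0 : p0 ∈ P) (hj : j + 1 ≤ P.card)
    (q : List V) (hq : q.Nodup) (hqP : ∀ v ∈ q, v ∉ P) (hqY : ∀ v ∈ q, v ∉ Y)
    (hqT : ∀ v ∈ q, v ∉ T) (hqc : List.IsChain R (t :: q ++ [p0]))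
    (hnum : T.card ≤ j → (Y.card : ℤ) <
      ((T.card : ℤ) + 1) * ((Y.card - s) - (j - (T.card - 1)) + 1) + (j - (T.card - 1) - 1)) :
    HasCyc R (2 * j + 2 + q.length) := by
  have hdisj : ∀ {a b : V}, a ∈ P → b ∈ XX x → a ≠ b := fun ha hb => h.disjUX (hPU ha) hb
  have hT1 : 1 ≤ T.card := Finset.card_pos.2 ⟨t, ht⟩
  obtain ⟨l, C, e, hl, hnd, hch, hlast, he, hC, hCc, hv⟩ :=
    alt_path R h.hR j (P.erase p0) Y (T.erase t) p0 (Y.card - s) (by simp)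
      (fun hh => hdisj hp0 (hYX hh) rfl)
      (fun hh => hdisj hp0 (hTX (Finset.mem_of_mem_erase hh)) rfl)
      (Finset.disjoint_left.2 fun a ha hb => hdisj (Finset.mem_of_mem_erase ha) (hYX hb) rfl)
      (Finset.disjoint_left.2 fun a ha hb => hdisj (Finset.mem_of_mem_erase ha)
        (hTX (Finset.mem_of_mem_erase hb)) rfl)
      (hYT.mono_right (Finset.erase_subset _ _))
      (by rw [Finset.card_erase_of_mem hp0]; omega)
      (by
        rw [Finset.insert_erase hp0]
        intro p hp t' ht'; exact hT p hp t' (Finset.mem_of_mem_erase ht'))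
      (by
        rw [Finset.insert_erase hp0]
        intro p hp; exact card_red_ge Y hYX p s (hs p hp))
      (by
        rw [Finset.card_erase_of_mem ht]
        intro hh
        have := hnum (by omega)
        have hc : (Y.card : ℤ) - s ≤ ((Y.card - s : ℕ) : ℤ) := by omega
        push_cast [hT1]
        nlinarith [mul_le_mul_of_nonneg_left hc (show (0 : ℤ) ≤ (T.card : ℤ) + 1 by positivity)])
  rw [Finset.insert_erase hp0] at he
  have htq : ∀ v ∈ t :: q, v ∉ P := by
    intro v hv hvP
    rcases List.mem_cons.1 hv with rfl | hv
    · exact hdisj hvP (hTX ht) rfl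
    · exact hqP v hv hvP
  refine close_path R j (P.erase p0) C p0 e t l q hl hnd hch hlast hv (fun hh => htq _ hh hp0)
    (fun v hv hh => htq v hv (Finset.mem_of_mem_erase hh)) ?_ ?_ (hT e he t ht) hqc
  · intro v hv hvC
    have := hC hvC
    rw [Finset.mem_union, Finset.mem_erase] at this
    rcases List.mem_cons.1 hv with rfl | hv
    · rcases this with h' | h'
      · exact Finset.disjoint_left.1 hYT h' ht
      · exact h'.1 rfl
    · rcases this with h' | h'
      · exact hqY v hv h'
      · exact hqT v hv h'.2
  · rw [List.nodup_cons]
    exact ⟨fun hh => hqT t hh ht, hq⟩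

/-- the case where all blue degrees to the cycle are small -/
lemma Ctx.small [NeZero n] (h : Ctx R n x U) (s j : ℕ) (P : Finset V) (hPU : P ⊆ U)
    (hs : ∀ p ∈ U, (SS R x p).card ≤ s) (hsn : 2 * s + j + 1 ≤ n)
    (p0 f : V) (hp0 : p0 ∈ P) (hf : f ∈ U) (hj : j + 1 ≤ P.card)
    (q : List V) (hq : q.Nodup) (hqP : ∀ v ∈ q, v ∉ P) (hqU : ∀ v ∈ q, v ∈ U)
    (hqc : ∀ t, R f t → List.IsChain R (t :: q ++ [p0])) :
    HasCyc R (2 * j + 2 + q.length) := by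
  have hdisj : ∀ {a b : V}, a ∈ P → b ∈ XX x → a ≠ b := fun ha hb => h.disjUX (hPU ha) hb
  obtain ⟨l, C, e, hl, hnd, hch, hlast, he, hC, hCc, hv⟩ :=
    alt_path R h.hR j (P.erase p0) (XX x) ∅ p0 (n - s) (by simp)
      (fun hh => hdisj hp0 hh rfl) (by simp)
      (Finset.disjoint_left.2 fun a ha hb => hdisj (Finset.mem_of_mem_erase ha) hb rfl)
      (by simp) (by simp)
      (by rw [Finset.card_erase_of_mem hp0]; omega) (by simp)
      (by
        rw [Finset.insert_erase hp0]
        intro p hp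
        have := card_red_ge (R := R) (XX x) subset_rfl p s (hs p (hPU hp))
        rwa [h.card_XX] at this)
      (by
        rw [h.card_XX]
        intro hh
        push_cast [show s ≤ n by omega]
        simp
        omega)
  rw [Finset.insert_erase hp0] at he
  rw [Finset.union_empty] at hC
  have hex : ∃ t ∈ XX x, t ∉ C ∧ R e t ∧ R f t := by
    by_contra hcon
    push Not at hcon
    have hsub : XX x ⊆ C ∪ ((XX x).filter (fun y => ¬ R e y) ∪ (XX x).filter (fun y => ¬ R f y)) := by
      intro t ht
      simp only [Finset.mem_union, Finset.mem_filter]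
      have := hcon t ht
      tauto
    have h1 := Finset.card_le_card hsub
    have h2 := Finset.card_union_le C
      ((XX x).filter (fun y => ¬ R e y) ∪ (XX x).filter (fun y => ¬ R f y))
    have h3 := Finset.card_union_le ((XX x).filter (fun y => ¬ R e y))
      ((XX x).filter (fun y => ¬ R f y))
    have h4 := (card_blue_le (R := R) (XX x) subset_rfl e).trans (hs e (hPU he))
    have h5 := (card_blue_le (R := R) (XX x) subset_rfl f).trans (hs f hf)
    rw [h.card_XX] at h1
    omega
  obtain ⟨t, htX, htC, het, hft⟩ := hex
  have htq : ∀ v ∈ t :: q, v ∉ P := by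
    intro v hv hvP
    rcases List.mem_cons.1 hv with rfl | hv
    · exact hdisj hvP htX rfl
    · exact hqP v hv hvP
  refine close_path R j (P.erase p0) C p0 e t l q hl hnd hch hlast hv (fun hh => htq _ hh hp0)
    (fun v hv hh => htq v hv (Finset.mem_of_mem_erase hh)) ?_ ?_ het (hqc t hft)
  · intro v hv hvC
    rcases List.mem_cons.1 hv with rfl | hv
    · exact htC hvC
    · exact h.disjUX (hqU v hv) (hC hvC) rfl
  · rw [List.nodup_cons]
    exact ⟨fun hh => h.disjUX (hqU t hh) htX rfl, hq⟩

lemma chain_of_all {V : Type*} (B : V → V → Prop) (l : List V) (hnd : l.Nodup)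
    (h : ∀ a ∈ l, ∀ b ∈ l, a ≠ b → B a b) : List.IsChain B l := by
  apply List.Pairwise.isChain
  exact List.Pairwise.imp_of_mem (fun {a b} ha hb hab => h a ha b hb hab) hnd

lemma hasCyc_of_clique {V : Type*} (B : V → V → Prop) (U : Finset V) (hU : 2 ≤ U.card)
    (h : ∀ a ∈ U, ∀ b ∈ U, a ≠ b → B a b) : HasCyc B U.card := by
  obtain ⟨a, ha⟩ : U.Nonempty := Finset.card_pos.1 (by omega)
  have hn : (a :: (U.erase a).toList).Nodup := by
    rw [List.nodup_cons]; exact ⟨by simp, Finset.nodup_toList _⟩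
  have hm : ∀ v ∈ a :: (U.erase a).toList, v ∈ U := by
    intro v hv
    rcases List.mem_cons.1 hv with rfl | hv
    · exact ha
    · simp at hv; exact hv.2
  have hlen : (U.erase a).toList.length = U.card - 1 := by
    rw [Finset.length_toList, Finset.card_erase_of_mem ha]
  refine ⟨a, (U.erase a).toList, by rw [List.length_cons, hlen]; omega, hn, ?_⟩
  rw [List.isChain_append]
  refine ⟨chain_of_all B _ hn (fun v hv w hw => h v (hm v hv) w (hm w hw)), by simp, ?_⟩
  intro v hv w hw
  simp at hw
  subst hw
  have hne : (U.erase a).toList ≠ [] := by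
    intro e; rw [e] at hlen; simp at hlen; omega
  rw [List.getLast?_cons, List.getLast?_eq_getLast_of_ne_nil hne] at hv
  simp at hv
  have hmem := List.getLast_mem hne
  rw [hv] at hmem
  simp at hmem
  exact h v hmem.2 a ha hmem.1
end RC

section RC
open Classical

variable {V : Type*} {R : V → V → Prop} {n : ℕ} {x : ZMod n → V} {U : Finset V}

lemma Ctx.wrapA [NeZero n] (h : Ctx R n x U) (s k : ℕ) (P T : Finset V) (hPU : P ⊆ U)
    (hTX : T ⊆ XX x) (hTc : T.card = s)
    (hT : ∀ p ∈ P, ∀ t ∈ T, R p t) (hs : ∀ p ∈ U, (SS R x p).card ≤ s)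
    (t p0 : V) (ht : t ∈ T) (hp0 : p0 ∈ P) (hk : k ≤ P.card) (hk1 : 1 ≤ k)
    (q : List V) (hq : q.Nodup) (hqP : ∀ v ∈ q, v ∉ P) (hqU : ∀ v ∈ q, v ∈ U)
    (hqc : List.IsChain R (t :: q ++ [p0]))
    (hnum : s < k → k + s < n) :
    HasCyc R (2 * k + q.length) := by
  have hq' : ∀ v ∈ q, v ∉ XX x := fun v hv hx => h.disjUX (hqU v hv) hx rfl
  have hs1 : 1 ≤ s := by rw [← hTc]; exact Finset.card_pos.2 ⟨t, ht⟩
  have := h.wrap s (k - 1) P T (XX x \ T) hPU hTX Finset.sdiff_subset Finset.sdiff_disjoint hT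
    (fun p hp => hs p (hPU hp)) t p0 ht hp0 (by omega) q hq hqP
    (fun v hv hh => hq' v hv (Finset.mem_sdiff.1 hh).1) (fun v hv hh => hq' v hv (hTX hh)) hqc ?_
  · rwa [show 2 * (k - 1) + 2 = 2 * k by omega] at this
  · intro hh
    have hc : (XX x \ T).card = n - s := by
      rw [Finset.card_sdiff_of_subset hTX, h.card_XX, hTc]
    rw [hTc] at hh ⊢
    have h1 := hnum (by omega)
    rw [hc]
    push_cast [show s ≤ n by omega, hk1]
    have e : (0 : ℤ) < s * (n - s - k) := mul_pos (by omega) (by omega)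
    nlinarith

lemma Ctx.wrapB [NeZero n] (h : Ctx R n x U) (s k : ℕ) (P T : Finset V) (hPU : P ⊆ U)
    (hTX : T ⊆ XX x) (hTc : T.card = s)
    (hT : ∀ p ∈ P, ∀ t ∈ T, R p t) (hs : ∀ p ∈ U, (SS R x p).card ≤ s)
    (t p0 y : V) (ht : t ∈ T) (hp0 : p0 ∈ P) (hk : k ≤ P.card + 1) (hk1 : 2 ≤ k)
    (hy : y ∈ XX x) (hyT : y ∉ T)
    (q : List V) (hq : q.Nodup) (hqP : ∀ v ∈ q, v ∉ P) (hqU : ∀ v ∈ q, v ∈ U ∨ v = y)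
    (hqc : List.IsChain R (t :: q ++ [p0]))
    (hnum : s + 1 < k → k + s < n) :
    HasCyc R (2 * (k - 1) + q.length) := by
  have hs1 : 1 ≤ s := by rw [← hTc]; exact Finset.card_pos.2 ⟨t, ht⟩
  have := h.wrap s (k - 2) P T ((XX x \ T).erase y) hPU hTX
    ((Finset.erase_subset _ _).trans Finset.sdiff_subset)
    (Finset.sdiff_disjoint.mono_left (Finset.erase_subset _ _)) hT
    (fun p hp => hs p (hPU hp)) t p0 ht hp0 (by omega) q hq hqP
    (fun v hv hh => by
      rw [Finset.mem_erase, Finset.mem_sdiff] at hh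
      rcases hqU v hv with h1 | h1
      · exact h.disjUX h1 hh.2.1 rfl
      · exact hh.1 h1)
    (fun v hv hh => by
      rcases hqU v hv with h1 | h1
      · exact h.disjUX h1 (hTX hh) rfl
      · exact hyT (h1 ▸ hh)) hqc ?_
  · rwa [show 2 * (k - 2) + 2 = 2 * (k - 1) by omega] at this
  · intro hh
    have hc : ((XX x \ T).erase y).card = n - s - 1 := by
      rw [Finset.card_erase_of_mem (Finset.mem_sdiff.2 ⟨hy, hyT⟩),
        Finset.card_sdiff_of_subset hTX, h.card_XX, hTc]
    rw [hTc] at hh ⊢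
    have h1 := hnum (by omega)
    rw [hc]
    push_cast [show s ≤ n by omega, show 1 ≤ n - s by omega, hk1]
    have e : (0 : ℤ) < s * (n - s - k) := mul_pos (by omega) (by omega)
    nlinarith

/-- `TT u 1` and `TT u 2` are disjoint and the like -/
lemma Ctx.disjTT [NeZero n] (h : Ctx R n x U) {u : V} (hu : u ∈ U) (c : ZMod n) :
    Disjoint (TT R x u c) (TT R x u (c + 1)) := by
  rw [Finset.disjoint_left]
  intro v hv hv'
  obtain ⟨i, hi, rfl⟩ := mem_TT.1 hv
  obtain ⟨j, hj, e⟩ := mem_TT.1 hv'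
  have e := h.inj e
  have e : i = j + 1 := by
    have : i + c = (j + 1) + c := by rw [e]; ring
    exact add_right_cancel this
  subst e
  exact hi (h.f1 hu hj)

lemma Ctx.two_s_le [NeZero n] (h : Ctx R n x U) {u : V} (hu : u ∈ U) :
    2 * (SS R x u).card ≤ n := by
  have h1 := Finset.card_union_of_disjoint (h.disjTT hu 0)
  rw [h.card_TT, h.card_TT] at h1
  have h2 := Finset.card_le_card (Finset.union_subset (TT_sub (R := R) (x := x) u 0)
    (TT_sub (R := R) (x := x) u (0 + 1)))
  rw [h1, h.card_XX] at h2
  omega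

/-- Lemma A1 -/
lemma Ctx.A1 [NeZero n] (h : Ctx R n x U) (k : ℕ) (hk1 : 1 ≤ k) {w : V} (hw : w ∈ U)
    (hs2 : 2 ≤ (SS R x w).card) (hks : k + 1 ≤ 2 * (SS R x w).card)
    (P : Finset V) (hPU : P ⊆ U) (hPw : w ∉ P) (hk : k ≤ P.card)
    (hb : ∀ p ∈ P, ¬ R w p) (hr : ∀ p ∈ P, ∀ t ∈ TT R x w 1, R p t) :
    HasCyc R (2 * k + 1) := by
  obtain ⟨i, hi, j, hj, hij⟩ := Finset.one_lt_card.1 hs2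
  rw [mem_SS] at hi hj
  have hr2 : ∀ p ∈ P, ∀ t ∈ TT R x w 2, R p t := by
    intro p hp t ht
    obtain ⟨l, hl, rfl⟩ := mem_TT.1 ht
    exact h.f3 hw (hPU hp) (fun e => hPw (e ▸ hp)) (hb p hp) hl
  have hd := h.disjTT hw 1
  rw [one_add_one_eq_two] at hd
  have hxj : x (j + 1) ∈ TT R x w 1 := mem_TT.2 ⟨j, hj, rfl⟩
  have hxi : x (i + 1) ∈ TT R x w 1 := mem_TT.2 ⟨i, hi, rfl⟩
  have hne : x (i + 1) ≠ x (j + 1) := fun e => hij (add_right_cancel (h.inj e))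
  obtain ⟨p0, hp0⟩ : P.Nonempty := Finset.card_pos.1 (by omega)
  have hsub : TT R x w 1 ∪ TT R x w 2 ⊆ XX x := Finset.union_subset (TT_sub _ _) (TT_sub _ _)
  have hcard : ((TT R x w 1 ∪ TT R x w 2).erase (x (j + 1))).card = 2 * (SS R x w).card - 1 := by
    rw [Finset.card_erase_of_mem (Finset.mem_union_left _ hxj), Finset.card_union_of_disjoint hd,
      h.card_TT, h.card_TT, two_mul]
  have := h.wrap n (k - 1) P ((TT R x w 1 ∪ TT R x w 2).erase (x (j + 1))) ∅ hPU
    ((Finset.erase_subset _ _).trans hsub) (by simp) (by simp)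
    (by
      intro p hp t ht
      rcases Finset.mem_union.1 (Finset.mem_of_mem_erase ht) with h1 | h1
      · exact hr p hp t h1
      · exact hr2 p hp t h1)
    (fun p hp => by have := h.two_s_le (hPU hp); omega)
    (x (i + 1)) p0 (Finset.mem_erase.2 ⟨hne, Finset.mem_union_left _ hxi⟩) hp0 (by omega)
    [x (j + 1)] (by simp) (by
      intro v hv hP
      rw [List.mem_singleton.1 hv] at hP
      exact h.hU _ (hPU hP) _ rfl) (by simp) (by simp)
    (by
      simp
      exact ⟨h.f2 hw hij hi hj, h.hR _ _ (hr p0 hp0 _ hxj)⟩) ?_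
  · rwa [show 2 * (k - 1) + 2 = 2 * k by omega] at this
  · rw [hcard]; intro hh; omega
end RC

section RC
open Classical

variable {V : Type*} {R : V → V → Prop} {n : ℕ} {x : ZMod n → V} {U : Finset V}

lemma Ctx.smallStep [NeZero n] (h : Ctx R n x U) (hU : U.card = n + 1) (m s : ℕ) (hm : 3 ≤ m)
    (hmn : m ≤ n + 1) (hs : ∀ p ∈ U, (SS R x p).card ≤ s) (hsm : 2 * s + m / 2 ≤ n) :
    HasCyc R m := by
  rcases Nat.even_or_odd' m with ⟨k, rfl | rfl⟩
  · obtain ⟨p, hp⟩ : U.Nonempty := Finset.card_pos.1 (by omega)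
    have := h.small s (k - 1) U subset_rfl hs (by omega) p p hp hp (by omega) [] (by simp)
      (by simp) (by simp) (fun t ht => by simpa using h.hR _ _ ht)
    simpa [show 2 * (k - 1) + 2 = 2 * k by omega] using this
  · have hex : ∃ a ∈ U, ∃ b ∈ U, a ≠ b ∧ R a b := by
      by_contra hcon
      push Not at hcon
      apply h.hno
      rw [← hU]
      exact hasCyc_of_clique _ U (by omega) hcon
    obtain ⟨a, ha, b, hb, hab, hr⟩ := hex
    have := h.small s (k - 1) (U.erase a) (Finset.erase_subset _ _) hs (by omega) b a
      (Finset.mem_erase.2 ⟨hab.symm, hb⟩) ha (by rw [Finset.card_erase_of_mem ha]; omega)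
      [a] (by simp) (by simp) (by simpa using ha)
      (fun t ht => by simpa using ⟨h.hR _ _ ht, hr⟩)
    simpa [show 2 * (k - 1) + 2 = 2 * k by omega] using this

lemma Ctx.evenP [NeZero n] (h : Ctx R n x U) (hU : U.card = n + 1) (k : ℕ) (hk : 2 ≤ k)
    (hkn : 2 * k ≤ n + 1) {u : V} (hu : u ∈ U) 
    (hs : ∀ p ∈ U, (SS R x p).card ≤ (SS R x u).card)
    (hsk : n + 1 ≤ 2 * (SS R x u).card + k) (c : ZMod n) (P : Finset V) (hPU : P ⊆ U)
    (hPk : k ≤ P.card) (hT : ∀ p ∈ P, ∀ t ∈ TT R x u c, R p t) : HasCyc R (2 * k) := by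
  obtain ⟨s, hs'⟩ : ∃ s, (SS R x u).card = s := ⟨_, rfl⟩
  rw [hs'] at hs hsk
  have hTc : (TT R x u c).card = s := by rw [h.card_TT, hs']
  obtain ⟨t, ht⟩ : (TT R x u c).Nonempty := Finset.card_pos.1 (by omega)
  obtain ⟨p0, hp0⟩ : P.Nonempty := Finset.card_pos.1 (by omega)
  by_cases hnum : s < k → k + s < n
  · have := h.wrapA s k P (TT R x u c) hPU (TT_sub _ _) hTc hT hs t p0 ht hp0 hPk (by omega) []
      (by simp) (by simp) (by simp) (by simpa using h.hR _ _ (hT p0 hp0 t ht)) hnum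
    simpa using this
  push Not at hnum
  obtain ⟨e1, e2⟩ : n = 2 * k - 1 ∧ s = k - 1 := by omega
  by_cases hs2 : 2 ≤ s
  · obtain ⟨i, hi1, hi2⟩ : ∃ i, x i ∉ TT R x u c ∧ x (i + 1) ∉ TT R x u c := by
      by_contra hcon
      push Not at hcon
      have : XX x ⊆ TT R x u c ∪ TT R x u (c - 1) := by
        intro v hv
        obtain ⟨i, rfl⟩ := exists_of_mem_XX hv
        rw [Finset.mem_union]
        by_cases h1 : x i ∈ TT R x u c
        · exact Or.inl h1
        · right
          obtain ⟨j, hj, e⟩ := mem_TT.1 (hcon i h1)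
          refine mem_TT.2 ⟨j, hj, ?_⟩
          have := h.inj e
          rw [show i = j + (c - 1) by rw [← add_sub_assoc, ← this]; ring]
      have h1 := Finset.card_le_card this
      have h2 := Finset.card_union_le (TT R x u c) (TT R x u (c - 1))
      rw [h.card_TT, h.card_TT] at h2
      rw [h.card_XX] at h1
      omega
    have hnn : x i ≠ x (i + 1) := by
      have := h.inj' i 0 1 (by omega) (by omega)
      simpa using this
    obtain ⟨p, hp, p', hp', hpp, hff⟩ := Finset.exists_ne_map_eq_of_card_lt_of_maps_to
      (s := P) (t := {x i, x (i + 1)}) (by rw [Finset.card_pair hnn]; omega)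
      (f := fun p => if R p (x i) then x i else x (i + 1))
      (by intro p hp; dsimp only; split_ifs <;> simp)
    have key : ∃ l, R p (x l) ∧ R p' (x l) ∧ x l ∉ TT R x u c := by
      by_cases h1 : R p (x i) <;> by_cases h2 : R p' (x i)
      · exact ⟨i, h1, h2, hi1⟩
      · simp [h1, h2, hnn] at hff
      · simp [h1, h2, hnn.symm] at hff
      · exact ⟨i + 1, h.f1 (hPU hp) h1, h.f1 (hPU hp') h2, hi2⟩
    obtain ⟨l, hl1, hl2, hl3⟩ := key
    have := h.wrapB s k (P.erase p) (TT R x u c) ((Finset.erase_subset _ _).trans hPU)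
      (TT_sub _ _) hTc (fun p hp => hT p (Finset.mem_of_mem_erase hp)) hs t p' (x l) ht
      (Finset.mem_erase.2 ⟨hpp.symm, hp'⟩) (by rw [Finset.card_erase_of_mem hp]; omega) hk
      (mem_XX l) hl3 [p, x l] (by simp; exact h.hU p (hPU hp) l)
      (by
        intro v hv
        simp at hv
        rcases hv with rfl | rfl
        · simp
        · intro hh; exact h.hU _ (hPU (Finset.mem_of_mem_erase hh)) _ rfl)
      (by
        intro v hv
        simp at hv
        rcases hv with rfl | rfl
        · exact Or.inl (hPU hp)
        · exact Or.inr rfl)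
      (by
        simp
        exact ⟨h.hR _ _ (hT p hp t ht), hl1, h.hR _ _ hl2⟩)
      (by omega)
    simpa [show 2 * (k - 1) + 2 = 2 * k by omega] using this
  · obtain rfl : k = 2 := by omega
    obtain rfl : s = 1 := by omega
    have hone : ∀ p ∈ U, ∃ i, ∀ j, j ≠ i → R p (x j) := by
      intro p hp
      by_cases h1 : ∃ i, ¬ R p (x i)
      · obtain ⟨i, hi⟩ := h1
        refine ⟨i, fun j hj => ?_⟩
        by_contra hc
        exact hj (Finset.card_le_one.1 (hs p hp) j (mem_SS.2 hc) i (mem_SS.2 hi))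
      · push Not at h1
        exact ⟨0, fun j _ => h1 j⟩
    choose! f hf using hone
    obtain ⟨p, hp, p', hp', hpp, hff⟩ := Finset.exists_ne_map_eq_of_card_lt_of_maps_to
      (s := U) (t := (Finset.univ : Finset (ZMod n)))
      (by rw [Finset.card_univ, ZMod.card]; omega) (f := f) (by intro p _; simp)
    have n1 := h.inj' (f p) 0 1 (by omega) (by omega)
    have n2 := h.inj' (f p) 0 2 (by omega) (by omega)
    have n3 := h.inj' (f p) 1 2 (by omega) (by omega)
    simp only [Nat.cast_zero, add_zero, Nat.cast_one] at n1 n2 n3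
    push_cast at n2 n3
    have d1 : f p + 1 ≠ f p := fun e => n1 (by rw [e])
    have d2 : f p + 2 ≠ f p := fun e => n2 (by rw [e])
    have a1 := hf p hp _ d1
    have a2 := hf p hp _ d2
    have a3 := hf p' hp' (f p + 1) (by rw [← hff]; exact d1)
    have a4 := hf p' hp' (f p + 2) (by rw [← hff]; exact d2)
    refine ⟨p, [x (f p + 1), p', x (f p + 2)], by simp, ?_, ?_⟩
    · have q1 := h.hU p hp (f p + 1)
      have q2 := h.hU p hp (f p + 2)
      have q3 := h.hU p' hp' (f p + 1)
      have q4 := h.hU p' hp' (f p + 2)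
      simp [q1, q2, hpp, n3, q4, q3.symm]
    · simp [a1, h.hR _ _ a2]
      exact ⟨h.hR _ _ a3, a4⟩

/-- vertices red to all of `TT u 1` -/
noncomputable def AA [NeZero n] (R : V → V → Prop) (x : ZMod n → V) (U : Finset V) (u : V) :
    Finset V := (U.erase u).filter (fun w => ∀ t ∈ TT R x u 1, R w t)

noncomputable def BB [NeZero n] (R : V → V → Prop) (x : ZMod n → V) (U : Finset V) (u : V) :
    Finset V := (U.erase u).filter (fun w => ¬ ∀ t ∈ TT R x u 1, R w t)

lemma card_AB [NeZero n] {u : V} (hu : u ∈ U) :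
    (AA R x U u).card + (BB R x U u).card = U.card - 1 := by
  rw [AA, BB, Finset.card_filter_add_card_filter_not, Finset.card_erase_of_mem hu]

lemma mem_AA [NeZero n] {u w : V} : w ∈ AA R x U u ↔
    (w ≠ u ∧ w ∈ U) ∧ ∀ t ∈ TT R x u 1, R w t := by
  rw [AA, Finset.mem_filter, Finset.mem_erase]

lemma mem_BB [NeZero n] {u w : V} : w ∈ BB R x U u ↔
    (w ≠ u ∧ w ∈ U) ∧ ∃ i, ¬ R u (x i) ∧ ¬ R w (x (i + 1)) := by
  rw [BB, Finset.mem_filter, Finset.mem_erase]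
  refine and_congr_right fun _ => ?_
  simp only [mem_TT]
  push Not
  constructor
  · rintro ⟨t, ⟨i, hi, rfl⟩, h2⟩; exact ⟨i, hi, h2⟩
  · rintro ⟨i, hi, h2⟩; exact ⟨_, ⟨i, hi, rfl⟩, h2⟩

lemma Ctx.red_BB [NeZero n] (h : Ctx R n x U) {u : V} (hu : u ∈ U) :
    ∀ p ∈ BB R x U u, ∀ t ∈ TT R x u 2, R p t := by
  intro p hp t ht
  obtain ⟨⟨hpu, hpU⟩, i, hi, hi'⟩ := mem_BB.1 hp
  obtain ⟨j, hj, rfl⟩ := mem_TT.1 ht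
  exact h.f4 hu hpU hpu.symm hi hj hi'

lemma Ctx.evenStep [NeZero n] (h : Ctx R n x U) (hU : U.card = n + 1) (k : ℕ) (hk : 2 ≤ k)
    (hkn : 2 * k ≤ n + 1) {u : V} (hu : u ∈ U) 
    (hs : ∀ p ∈ U, (SS R x p).card ≤ (SS R x u).card)
    (hsk : n + 1 ≤ 2 * (SS R x u).card + k) : HasCyc R (2 * k) := by
  have hc := card_AB (R := R) (x := x) hu
  by_cases hB : k ≤ (BB R x U u).card
  · exact h.evenP hU k hk hkn hu hs hsk 2 (BB R x U u) (fun v hv => (mem_BB.1 hv).1.2) hB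
      (h.red_BB hu)
  · refine h.evenP hU k hk hkn hu hs hsk 1 (insert u (AA R x U u)) ?_ ?_ ?_
    · intro v hv
      rcases Finset.mem_insert.1 hv with rfl | hv
      · exact hu
      · exact (mem_AA.1 hv).1.2
    · rw [Finset.card_insert_of_notMem (fun hh => (mem_AA.1 hh).1.1 rfl)]
      omega
    · intro v hv t ht
      rcases Finset.mem_insert.1 hv with rfl | hv
      · obtain ⟨i, hi, rfl⟩ := mem_TT.1 ht
        exact h.f1 hu hi
      · exact (mem_AA.1 hv).2 t ht
end RC

section RC
open Classical

variable {V : Type*} {R : V → V → Prop} {n : ℕ} {x : ZMod n → V} {U : Finset V}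

lemma exists_mid (Q : Finset V) (b1 b : V) (h1 : b1 ∈ Q) (hb : b ∈ Q) (hne : b ≠ b1) (c : ℕ)
    (hc2 : 2 ≤ c) (hc : c ≤ Q.card) : ∃ L : List V, L.length = c - 2 ∧ L.Nodup ∧
      ∀ v ∈ L, v ∈ Q ∧ v ≠ b1 ∧ v ≠ b := by
  obtain ⟨W, hW, hWc⟩ := Finset.exists_subset_card_eq (s := (Q.erase b1).erase b) (n := c - 2)
    (by
      rw [Finset.card_erase_of_mem (Finset.mem_erase.2 ⟨hne, hb⟩), Finset.card_erase_of_mem h1]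
      omega)
  refine ⟨W.toList, by simp [hWc], Finset.nodup_toList _, fun v hv => ?_⟩
  have := hW (Finset.mem_toList.1 hv)
  simp only [Finset.mem_erase] at this
  exact ⟨this.2.2, this.2.1, this.1⟩

/-- no suitable blue segment, forward version -/
lemma Ctx.noFwd (h : Ctx R n x U) {u b1 b : V} (hu : u ∈ U) (Q : Finset V) (hQ : Q ⊆ U)
    (huQ : u ∉ Q) (hcl : ∀ p ∈ Q, ∀ p' ∈ Q, p ≠ p' → ¬ R p p') (h1 : b1 ∈ Q) (hb : b ∈ Q)
    (hne : b ≠ b1) (hub : ¬ R u b1) (i : ZMod n) (v : ℕ) (hv0 : 0 < v) (hc2 : v + 2 ≤ n)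
    (hc : n ≤ Q.card + v) (he : ¬ R b (x i)) (hs : ¬ R u (x (i + ((v - 1 : ℕ) : ZMod n)))) :
    False := by
  obtain ⟨L, hL, hLn, hLm⟩ := exists_mid Q b1 b h1 hb hne (n - v) (by omega) (by omega)
  have hnd : (b1 :: (L ++ [b])).Nodup := by
    simp [List.nodup_append, hLn, hne.symm]
    exact ⟨fun hh => (hLm _ hh).2.1 rfl, fun a ha e => (hLm a ha).2.2 e⟩
  have hmem : ∀ w ∈ b1 :: (L ++ [b]), w ∈ Q := by
    intro w hw
    simp at hw
    rcases hw with rfl | hw | rfl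
    · exact h1
    · exact (hLm w hw).1
    · exact hb
  refine h.f5 i v hv0 (by omega) u b (b1 :: (L ++ [b])) (by simp [hL]; omega) ?_ ?_ ?_ ?_ he hs
  · rw [List.nodup_cons]; exact ⟨fun hh => huQ (hmem u hh), hnd⟩
  · intro w hw
    rcases List.mem_cons.1 hw with rfl | hw
    · exact hu
    · exact hQ (hmem w hw)
  · rw [List.isChain_cons_cons]
    exact ⟨hub, chain_of_all _ _ hnd (fun p hp p' hp' => hcl p (hmem p hp) p' (hmem p' hp'))⟩
  · simp [List.getLast?_cons]

lemma Ctx.noBwd (h : Ctx R n x U) {u b1 b : V} (hu : u ∈ U) (Q : Finset V) (hQ : Q ⊆ U)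
    (huQ : u ∉ Q) (hcl : ∀ p ∈ Q, ∀ p' ∈ Q, p ≠ p' → ¬ R p p') (h1 : b1 ∈ Q) (hb : b ∈ Q)
    (hne : b ≠ b1) (hub : ¬ R u b1) (i : ZMod n) (v : ℕ) (hv0 : 0 < v) (hc2 : v + 2 ≤ n)
    (hc : n ≤ Q.card + v) (he : ¬ R u (x i)) (hs : ¬ R b (x (i + ((v - 1 : ℕ) : ZMod n)))) :
    False := by
  obtain ⟨L, hL, hLn, hLm⟩ := exists_mid Q b1 b h1 hb hne (n - v) (by omega) (by omega)
  have hnd : (b :: (L ++ [b1])).Nodup := by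
    simp [List.nodup_append, hLn, hne]
    exact ⟨fun hh => (hLm _ hh).2.2 rfl, fun a ha e => (hLm a ha).2.1 e⟩
  have hmem : ∀ w ∈ b :: (L ++ [b1]), w ∈ Q := by
    intro w hw
    simp at hw
    rcases hw with rfl | hw | rfl
    · exact hb
    · exact (hLm w hw).1
    · exact h1
  have heq : b :: (L ++ [b1, u]) = (b :: (L ++ [b1])) ++ [u] := by simp
  refine h.f5 i v hv0 (by omega) b u (L ++ [b1, u]) (by simp [hL]; omega) ?_ ?_ ?_ ?_ he hs
  · rw [heq, List.nodup_append]
    refine ⟨hnd, by simp, ?_⟩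
    intro a ha c hc e
    simp at hc
    exact huQ (hc ▸ e ▸ hmem a ha)
  · intro w hw
    rw [heq, List.mem_append] at hw
    rcases hw with hw | hw
    · exact hQ (hmem w hw)
    · simp at hw; exact hw ▸ hu
  · rw [heq, List.isChain_append]
    refine ⟨chain_of_all _ _ hnd (fun p hp p' hp' => hcl p (hmem p hp) p' (hmem p' hp')),
      by simp, ?_⟩
    intro a ha c hc
    simp [List.getLast?_cons] at ha hc
    subst ha; subst hc
    exact fun hh => hub (h.hR _ _ hh)
  · rw [heq]; exact List.getLast?_concat

lemma Ctx.B2 [NeZero n] (h : Ctx R n x U) (k : ℕ) (hk : 2 ≤ k)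
    (hkn : 2 * k ≤ n) {u b1 : V} (hu : u ∈ U)
    (hsk : n + 1 ≤ 2 * (SS R x u).card + k)
    (hB : n + 1 ≤ (BB R x U u).card + k)
    (hcl : ∀ p ∈ BB R x U u, ∀ p' ∈ BB R x U u, p ≠ p' → ¬ R p p')
    (h1 : b1 ∈ BB R x U u) (hub : ¬ R u b1) : False := by
  obtain ⟨b, hb, hne⟩ := Finset.exists_mem_ne (s := BB R x U u) (by omega) b1
  obtain ⟨-, i, hi, hbi⟩ := mem_BB.1 hb
  have hQ : BB R x U u ⊆ U := fun v hv => (mem_BB.1 hv).1.2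
  have huQ : u ∉ BB R x U u := fun hh => (mem_BB.1 hh).1.1 rfl
  by_cases hs3 : 3 ≤ (SS R x u).card
  · have key : ∃ v : ℕ, 4 ≤ v ∧ v + 2 ≤ n ∧ ¬ R u (x (i + (v : ZMod n))) := by
      have hone : ∀ j, j ≠ i → ¬ R u (x j) → ∃ v : ℕ, 2 ≤ v ∧ v + 2 ≤ n ∧ j = i + (v : ZMod n) := by
        intro j hj hjr
        obtain ⟨v, hv0, hvn, rfl⟩ := h.exists_nat i j hj.symm
        refine ⟨v, ?_, ?_, rfl⟩
        · by_contra hc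
          obtain rfl : v = 1 := by omega
          exact hjr (by simpa using h.f1 hu hi)
        · by_contra hc
          obtain rfl : v = n - 1 := by omega
          have := h.f1 hu hjr
          rw [Nat.cast_sub (by omega)] at this
          simp at this
          exact hi this
      have hcard : 1 < ((SS R x u).erase i).card := by
        rw [Finset.card_erase_of_mem (mem_SS.2 hi)]; omega
      obtain ⟨j, hj, j', hj', hjj⟩ := Finset.one_lt_card.1 hcard
      rw [Finset.mem_erase, mem_SS] at hj hj'
      obtain ⟨v, hv1, hv2, rfl⟩ := hone j hj.1 hj.2
      obtain ⟨v', hv1', hv2', rfl⟩ := hone j' hj'.1 hj'.2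
      by_contra hcon
      push Not at hcon
      have e1 : v < 4 := by
        by_contra hc; exact hj.2 (hcon v (by omega) hv2)
      have e2 : v' < 4 := by
        by_contra hc; exact hj'.2 (hcon v' (by omega) hv2')
      have e3 : v ≠ v' := fun e => hjj (by rw [e])
      have e4 : (v = 2 ∧ v' = 3) ∨ (v = 3 ∧ v' = 2) := by omega
      rcases e4 with ⟨rfl, rfl⟩ | ⟨rfl, rfl⟩
      · apply hj'.2
        have := h.f1 hu hj.2
        push_cast at this ⊢
        rwa [add_assoc, show (2 : ZMod n) + 1 = 3 by norm_num] at this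
      · apply hj.2
        have := h.f1 hu hj'.2
        push_cast at this ⊢
        rwa [add_assoc, show (2 : ZMod n) + 1 = 3 by norm_num] at this
    obtain ⟨v, hv4, hvn, hvr⟩ := key
    by_cases hv : n ≤ (BB R x U u).card + v
    · refine h.noFwd hu _ hQ huQ hcl h1 hb hne hub (i + 1) v (by omega) hvn hv hbi ?_
      rw [Nat.cast_sub (by omega), Nat.cast_one, add_assoc, add_sub_cancel]
      exact hvr
    · refine h.noBwd hu _ hQ huQ hcl h1 hb hne hub (i + (v : ZMod n)) (n + 2 - v) (by omega)
        (by omega) (by omega) hvr ?_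
      rw [show n + 2 - v - 1 = n + 1 - v by omega, Nat.cast_sub (by omega), add_assoc,
        add_sub_cancel]
      simpa using hbi
  · refine h.noBwd hu _ hQ huQ hcl h1 hb hne hub i 2 (by omega) (by omega) (by omega) hi ?_
    simpa using hbi

lemma Ctx.oddStep [NeZero n] (h : Ctx R n x U) (hU : U.card = n + 1) (k : ℕ) (hk : 2 ≤ k)
    (hkn : 2 * k ≤ n) {u : V} (hu : u ∈ U)
    (hs : ∀ p ∈ U, (SS R x p).card ≤ (SS R x u).card)
    (hsk : n + 1 ≤ 2 * (SS R x u).card + k) : HasCyc R (2 * k + 1) := by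
  have hc := card_AB (R := R) (x := x) hu
  have hQ : BB R x U u ⊆ U := fun v hv => (mem_BB.1 hv).1.2
  have huQ : u ∉ BB R x U u := fun hh => (mem_BB.1 hh).1.1 rfl
  obtain ⟨i, hi⟩ : (SS R x u).Nonempty := Finset.card_pos.1 (by omega)
  rw [mem_SS] at hi
  have ht1 : x (i + 1) ∈ TT R x u 1 := mem_TT.2 ⟨i, hi, rfl⟩
  have ht2 : x (i + 2) ∈ TT R x u 2 := mem_TT.2 ⟨i, hi, rfl⟩
  by_cases hA : k ≤ (AA R x U u).card
  · have hAU : AA R x U u ⊆ U := fun v hv => (mem_AA.1 hv).1.2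
    have huA : u ∉ AA R x U u := fun hh => (mem_AA.1 hh).1.1 rfl
    by_cases hall : ∀ a ∈ AA R x U u, ¬ R u a
    · exact h.A1 k (by omega) hu (by omega) (by omega) _ hAU huA hA hall
        (fun p hp => (mem_AA.1 hp).2)
    · push Not at hall
      obtain ⟨a, ha, hra⟩ := hall
      exact h.wrapA (SS R x u).card k (AA R x U u) (TT R x u 1) hAU (TT_sub _ _) (h.card_TT _ _)
        (fun p hp => (mem_AA.1 hp).2) hs (x (i + 1)) a ht1 ha hA (by omega) [u] (by simp)
        (by simpa using huA) (by simpa using hu)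
        (by simpa using ⟨h.hR _ _ (h.f1 hu hi), hra⟩) (by omega)
  by_cases hcl : ∀ p ∈ BB R x U u, ∀ p' ∈ BB R x U u, p ≠ p' → ¬ R p p'
  swap
  · push Not at hcl
    obtain ⟨b, hb, b', hb', hne, hr⟩ := hcl
    exact h.wrapA (SS R x u).card k ((BB R x U u).erase b) (TT R x u 2)
      ((Finset.erase_subset _ _).trans hQ) (TT_sub _ _) (h.card_TT _ _)
      (fun p hp => h.red_BB hu p (Finset.mem_of_mem_erase hp)) hs (x (i + 2)) b' ht2
      (Finset.mem_erase.2 ⟨hne.symm, hb'⟩) (by rw [Finset.card_erase_of_mem hb]; omega) (by omega)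
      [b] (by simp) (by simp) (by simpa using hQ hb)
      (by simpa using ⟨h.hR _ _ (h.red_BB hu b hb _ ht2), hr⟩) (by omega)
  by_cases hub : ∃ b1 ∈ BB R x U u, ¬ R u b1
  · obtain ⟨b1, hb1, hub⟩ := hub
    exact (h.B2 k hk hkn hu hsk (by omega) hcl hb1 hub).elim
  push Not at hub
  by_cases hy : ∃ b ∈ BB R x U u, ∃ y ∈ TT R x u 1, R b y
  · obtain ⟨b, hb, y, hy, hby⟩ := hy
    obtain ⟨b', hb', hne⟩ := Finset.exists_mem_ne (s := BB R x U u) (by omega) b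
    have hyT : y ∉ TT R x u 2 := by
      have := h.disjTT hu 1
      rw [one_add_one_eq_two] at this
      exact Finset.disjoint_left.1 this hy
    have hyX := TT_sub _ _ hy
    have huy : R u y := by
      obtain ⟨j, hj, rfl⟩ := mem_TT.1 hy
      exact h.f1 hu hj
    have hbu : b ≠ u := fun e => huQ (e ▸ hb)
    have := h.wrapB (SS R x u).card k ((BB R x U u).erase b) (TT R x u 2)
      ((Finset.erase_subset _ _).trans hQ) (TT_sub _ _) (h.card_TT _ _)
      (fun p hp => h.red_BB hu p (Finset.mem_of_mem_erase hp)) hs (x (i + 2)) b' y ht2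
      (Finset.mem_erase.2 ⟨hne, hb'⟩) (by rw [Finset.card_erase_of_mem hb]; omega) hk hyX hyT
      [b, y, u]
      (by
        have e1 := h.disjUX (hQ hb) hyX
        have e2 := (h.disjUX hu hyX).symm
        simp [e1, e2, hbu])
      (by
        intro v hv
        simp only [List.mem_cons, List.not_mem_nil, or_false] at hv
        rcases hv with rfl | rfl | rfl
        · simp
        · intro hh; exact h.disjUX (hQ (Finset.mem_of_mem_erase hh)) hyX rfl
        · intro hh; exact huQ (Finset.mem_of_mem_erase hh))
      (by
        intro v hv
        simp only [List.mem_cons, List.not_mem_nil, or_false] at hv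
        rcases hv with rfl | rfl | rfl
        · exact Or.inl (hQ hb)
        · exact Or.inr rfl
        · exact Or.inl hu)
      (by
        simp
        exact ⟨h.hR _ _ (h.red_BB hu b hb _ ht2), hby, h.hR _ _ huy, hub b' hb'⟩) (by omega)
    rwa [show 2 * (k - 1) + [b, y, u].length = 2 * k + 1 by simp; omega] at this
  push Not at hy
  obtain ⟨b, hb⟩ : (BB R x U u).Nonempty := Finset.card_pos.1 (by omega)
  have hSb : (SS R x u).image (fun i => i + 1) = SS R x b := by
    apply Finset.eq_of_subset_of_card_le
    · intro j hj
      obtain ⟨i', hi', rfl⟩ := Finset.mem_image.1 hj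
      exact mem_SS.2 (hy b hb _ (mem_TT.2 ⟨i', mem_SS.1 hi', rfl⟩))
    · rw [Finset.card_image_of_injective _ (add_left_injective 1)]
      exact hs b (hQ hb)
  have hSc : (SS R x b).card = (SS R x u).card := by
    rw [← hSb, Finset.card_image_of_injective _ (add_left_injective 1)]
  refine h.A1 k (by omega) (hQ hb) (by omega) (by omega) ((BB R x U u).erase b)
    ((Finset.erase_subset _ _).trans hQ) (by simp) (by rw [Finset.card_erase_of_mem hb]; omega)
    ?_ ?_
  · intro p hp
    rw [Finset.mem_erase] at hp
    exact hcl b hb p hp.2 hp.1.symm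
  · intro p hp t ht
    obtain ⟨j, hj, rfl⟩ := mem_TT.1 ht
    have hj' : j ∈ (SS R x u).image (fun i => i + 1) := by rw [hSb]; exact mem_SS.2 hj
    obtain ⟨i', hi', rfl⟩ := Finset.mem_image.1 hj'
    refine h.red_BB hu p (Finset.mem_of_mem_erase hp) _ (mem_TT.2 ⟨i', mem_SS.1 hi', ?_⟩)
    rw [add_assoc, one_add_one_eq_two]

theorem Ctx.step (h : Ctx R n x U) (hU : U.card = n + 1) (m : ℕ) (hm : 3 ≤ m)
    (hmn : m ≤ n + 1) : HasCyc R m := by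
  have hn := h.hn
  have : NeZero n := ⟨by omega⟩
  obtain ⟨u, hu, hs⟩ := Finset.exists_max_image U (fun p => (SS R x p).card)
    (Finset.card_pos.1 (by omega))
  by_cases hsm : 2 * (SS R x u).card + m / 2 ≤ n
  · exact h.smallStep hU m _ hm hmn hs hsm
  rcases Nat.even_or_odd' m with ⟨k, rfl | rfl⟩
  · exact h.evenStep hU k (by omega) (by omega) hu hs (by omega)
  · by_cases hk : 2 ≤ k
    · exact h.oddStep hU k hk (by omega) hu hs (by omega)
    · obtain rfl : k = 1 := by omega
      obtain ⟨i, hi, j, hj, hij⟩ := Finset.one_lt_card.1 (show 1 < (SS R x u).card by omega)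
      rw [mem_SS] at hi hj
      have hne : x (i + 1) ≠ x (j + 1) := fun e => hij (add_right_cancel (h.inj e))
      refine ⟨u, [x (i + 1), x (j + 1)], by simp, ?_, ?_⟩
      · simp [hne, h.hU u hu]
      · simp [h.f1 hu hi, h.f2 hu hij hi hj, h.hR _ _ (h.f1 hu hj)]
end RC

section RC
open Classical

lemma hasCyc_tri {V : Type*} {R : V → V → Prop} {a b c : V} (hab : a ≠ b) (hac : a ≠ c)
    (hbc : b ≠ c) (h1 : R a b) (h2 : R b c) (h3 : R c a) : HasCyc R 3 :=
  ⟨a, [b, c], by simp, by simp [hab, hac, hbc], by simp [h1, h2, h3]⟩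

lemma tri_aux {V : Type*} (R : V → V → Prop) (hR : ∀ a b, R a b → R b a) (v : V) (W : Finset V)
    (hv : v ∉ W) (hW : 3 ≤ W.card) (hr : ∀ w ∈ W, R v w) :
    HasCyc R 3 ∨ HasCyc (fun a b => ¬ R a b) 3 := by
  by_cases h : ∃ a ∈ W, ∃ b ∈ W, a ≠ b ∧ R a b
  · obtain ⟨a, ha, b, hb, hab, hh⟩ := h
    exact Or.inl (hasCyc_tri (ne_of_mem_of_not_mem ha hv).symm (ne_of_mem_of_not_mem hb hv).symm hab (hr a ha) hh
      (hR _ _ (hr b hb)))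
  · push Not at h
    obtain ⟨W', hW', hc⟩ := Finset.exists_subset_card_eq hW
    right
    have := hasCyc_of_clique (fun a b => ¬ R a b) W' (by omega)
      (fun a ha b hb => h a (hW' ha) b (hW' hb))
    rwa [hc] at this

lemma tri_base {V : Type*} [Fintype V] (R : V → V → Prop) (hR : ∀ a b, R a b → R b a)
    (hV : 6 ≤ Fintype.card V) : HasCyc R 3 ∨ HasCyc (fun a b => ¬ R a b) 3 := by
  obtain ⟨v⟩ : Nonempty V := Fintype.card_pos_iff.1 (by omega)
  have h1 := Finset.card_filter_add_card_filter_not (s := Finset.univ.erase v) (fun w => R v w)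
  rw [Finset.card_erase_of_mem (Finset.mem_univ v), Finset.card_univ] at h1
  by_cases h3 : 3 ≤ ((Finset.univ.erase v).filter (fun w => R v w)).card
  · exact tri_aux R hR v _ (by simp) h3 (fun w hw => (Finset.mem_filter.1 hw).2)
  · have := tri_aux (fun a b => ¬ R a b) (fun a b hh h' => hh (hR _ _ h')) v
      ((Finset.univ.erase v).filter (fun w => ¬ R v w)) (by simp) (by omega)
      (fun w hw => (Finset.mem_filter.1 hw).2)
    simp only [not_not] at this
    exact this.symm

lemma step_all {V : Type*} [Fintype V] (R : V → V → Prop) (hR : ∀ a b, R a b → R b a)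
    (n a : ℕ) (hn : 3 ≤ n) (ha : 3 ≤ a) (han : a ≤ n + 1) (hV : 2 * n + 1 ≤ Fintype.card V)
    (hc : HasCyc (fun a b => ¬ R a b) n) : HasCyc R a ∨ HasCyc (fun a b => ¬ R a b) (n + 1) := by
  by_cases hno : HasCyc (fun a b => ¬ R a b) (n + 1)
  · exact Or.inr hno
  left
  have : NeZero n := ⟨by omega⟩
  obtain ⟨x, hx, hb⟩ := hc.exists_fun (by omega)
  have hX : (XX x).card = n := by
    rw [XX, Finset.card_image_of_injective _ hx, Finset.card_univ, ZMod.card]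
  obtain ⟨U, hU, hUc⟩ := Finset.exists_subset_card_eq (s := (XX x)ᶜ) (n := n + 1)
    (by rw [Finset.card_compl, hX]; omega)
  have ctx : Ctx R n x U :=
    { hR := hR, hn := hn, inj := hx, blue := hb, hno := hno
      hU := by
        intro u hu i e
        have := hU hu
        rw [Finset.mem_compl] at this
        exact this (e ▸ mem_XX i) }
  exact ctx.step hUc a ha han

theorem main_ind {V : Type*} [Fintype V] (b : ℕ) (hb : 3 ≤ b) :
    ∀ (a : ℕ) (R : V → V → Prop), (∀ a b, R a b → R b a) → 3 ≤ a → a ≤ b →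
      6 ≤ Fintype.card V → 2 * b ≤ Fintype.card V + 1 →
      HasCyc R a ∨ HasCyc (fun a b => ¬ R a b) b := by
  induction b, hb using Nat.le_induction with
  | base =>
    intro a R hR ha hab h6 _
    obtain rfl : a = 3 := by omega
    exact tri_base R hR h6
  | succ n hn ih =>
    intro a R hR ha hab h6 hV
    have key : ∀ a (R : V → V → Prop), (∀ a b, R a b → R b a) → 3 ≤ a → a ≤ n →
        HasCyc R a ∨ HasCyc (fun a b => ¬ R a b) (n + 1) := by
      intro a R hR ha han
      rcases ih a R hR ha han h6 (by omega) with h | h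
      · exact Or.inl h
      · exact step_all R hR n a hn ha (by omega) (by omega) h
    by_cases han : a ≤ n
    · exact key a R hR ha han
    · obtain rfl : a = n + 1 := by omega
      rcases key n R hR hn le_rfl with h | h
      · have := step_all (fun a b => ¬ R a b) (fun a b hh h' => hh (hR _ _ h')) n (n + 1) hn ha
          le_rfl (by omega) (by simpa only [not_not] using h)
        simp only [not_not] at this
        exact this.symm
      · exact Or.inr h
end RC

section RC

lemma emb_of_hasCyc {V : Type*} {R : V → V → Prop} (hR : ∀ a b, R a b → R b a) (m : ℕ)
    (hm : 2 ≤ m) (h : HasCyc R m) :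
    ∃ f : Fin m ↪ V, ∀ u v, (cycleGraph m).Adj u v → R (f u) (f v) := by
  obtain ⟨x, hx, hb⟩ := h.exists_fun hm
  obtain ⟨k, rfl⟩ : ∃ k, m = k + 2 := ⟨m - 2, by omega⟩
  have hb' : ∀ i : Fin (k + 2), R (x i) (x (i + 1 : Fin (k + 2))) := hb
  refine ⟨⟨x, hx⟩, fun u v huv => ?_⟩
  rw [cycleGraph_adj] at huv
  rcases huv with e | e
  · rw [sub_eq_iff_eq_add'] at e
    subst e
    exact hR _ _ (hb' v)
  · rw [sub_eq_iff_eq_add'] at e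
    subst e
    exact hb' u

lemma upper (m n : ℕ) (hm : 3 ≤ m) (hmn : m ≤ n) (hn : 4 ≤ n) :
    RamseyProp (cycleGraph m) (cycleGraph n) (2 * n - 1) := by
  intro c
  have hR : ∀ a b : Fin (2 * n - 1), c s(a, b) = 0 → c s(b, a) = 0 := by
    intro a b h; rwa [Sym2.eq_swap]
  rcases main_ind (V := Fin (2 * n - 1)) n (by omega) m (fun a b => c s(a, b) = 0) hR hm hmn
    (by rw [Fintype.card_fin]; omega) (by rw [Fintype.card_fin]; omega) with h | h
  · exact Or.inl (emb_of_hasCyc hR m (by omega) h)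
  · obtain ⟨f, hf⟩ := emb_of_hasCyc (fun a b hh h' => hh (hR _ _ h')) n (by omega) h
    refine Or.inr ⟨f, fun u v huv => ?_⟩
    have := hf u v huv
    omega

lemma lower (m n N : ℕ) (hm : 3 ≤ m) (hodd : Odd m) (hn : 3 ≤ n)
    (h : RamseyProp (cycleGraph m) (cycleGraph n) N) : 2 * n - 1 ≤ N := by
  classical
  by_contra hN
  let c : Sym2 (Fin N) → Fin 2 := Sym2.lift
    ⟨fun i j => if (i.val < n - 1 ↔ j.val < n - 1) then 1 else 0, by
      intro i j
      simp only [iff_comm]⟩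
  have hc : ∀ i j : Fin N, c s(i, j) = if (i.val < n - 1 ↔ j.val < n - 1) then 1 else 0 :=
    fun i j => rfl
  rcases h c with ⟨f, hf⟩ | ⟨f, hf⟩
  · have col : (cycleGraph m).Coloring Bool :=
      Coloring.mk (fun v => decide ((f v).val < n - 1)) (by
        intro u v huv e
        have h1 := hf u v huv
        rw [hc] at h1
        rw [decide_eq_decide] at e
        rw [if_pos e] at h1
        exact one_ne_zero h1)
    have h2 : (cycleGraph m).Colorable 2 := by simpa using col.colorable
    have h3 := h2.chromaticNumber_le
    rw [chromaticNumber_cycleGraph_of_odd m (by omega) hodd] at h3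
    exact absurd h3 (by decide)
  · have hadj : ∀ u v, (cycleGraph n).Adj u v → ((f u).val < n - 1 ↔ (f v).val < n - 1) := by
      intro u v huv
      have h1 := hf u v huv
      rw [hc] at h1
      by_contra hh
      rw [if_neg hh] at h1
      exact zero_ne_one h1
    have hall : ∀ u v, ((f u).val < n - 1 ↔ (f v).val < n - 1) := by
      intro u v
      obtain ⟨w⟩ := cycleGraph_preconnected u v
      induction w with
      | nil => rfl
      | cons hh _ ih => exact (hadj _ _ hh).trans ih
    have hmap : ∃ g : Fin n → Fin (n - 1), Function.Injective g := by
      by_cases h0 : (f ⟨0, by omega⟩).val < n - 1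
      · refine ⟨fun v => ⟨(f v).val, (hall _ _).1 h0⟩, fun a b e => ?_⟩
        simp only [Fin.mk.injEq] at e
        exact f.injective (Fin.ext e)
      · have h1 : ∀ v, n - 1 ≤ (f v).val := fun v => by
          by_contra hh; exact h0 ((hall v _).1 (by omega))
        refine ⟨fun v => ⟨(f v).val - (n - 1), by have := (f v).isLt; omega⟩, fun a b e => ?_⟩
        simp only [Fin.mk.injEq] at e
        have := h1 a
        have := h1 b
        exact f.injective (Fin.ext (by omega))
    obtain ⟨g, hg⟩ := hmap
    have := Fintype.card_le_of_injective g hg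
    simp at this
    omega
end RC

theorem ramsey_cycles_odd (m n : ℕ) (hm : 3 ≤ m) (hmn : m ≤ n) (hodd : Odd m)
    (hne : (m, n) ≠ (3, 3)) :
    ramseyNumber (cycleGraph m) (cycleGraph n) = 2 * n - 1 := by
  have hn : 4 ≤ n := by
    by_contra h
    exact hne (by rw [Prod.mk.injEq]; omega)
  have : IsLeast {N | RamseyProp (cycleGraph m) (cycleGraph n) N} (2 * n - 1) :=
    ⟨upper m n hm hmn hn, fun N hN => lower m n N hm hodd (by omega) hN⟩
  exact this.csInf_eq
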